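/- arXiv:2511.12601 — 2 statements merged into one kernel-verified Lean document; each statement's English description precedes it below -/
import Mathlib

section
/- Let N be a positive integer and C an N×N real matrix. The maximum of ⟨P·Q, C⟩_F over all permutation matrices P and all diagonal matrices Q with diagonal entries in {+1,−1} equals the maximum of ⟨P, |C|⟩_F over all permutation matrices P, where |C| is the entrywise absolute value of C. In particular, the joint permutation-plus-sign matching problem reduces to a standard linear assignment problem on the matrix of absolute values of the cost matrix. -/
/-- The Frobenius product of a signed permutation matrix with `C`, as a single sum. -/
theorem sum_permMatrix_mul_diagonal_mul {n : Type*} [Fintype n] [DecidableEq n]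
    (π : Equiv.Perm n) (q : n → ℝ) (C : Matrix n n ℝ) :
    ∑ i, ∑ j,
        ((Matrix.of fun i j => if j = π i then (1 : ℝ) else 0) * Matrix.diagonal q) i j * C i j
      = ∑ i, q (π i) * C i (π i) := by
  simp [Matrix.mul_diagonal]

/-- The Frobenius product of a permutation matrix with `|C|`, as a single sum. -/
theorem sum_permMatrix_mul_abs {n : Type*} [Fintype n] [DecidableEq n]
    (π : Equiv.Perm n) (C : Matrix n n ℝ) :
    ∑ i, ∑ j, (if j = π i then (1 : ℝ) else 0) * |C i j| = ∑ i, |C i (π i)| := by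
  simp

theorem sign_mul_le_abs {s : ℝ} (hs : s = 1 ∨ s = -1) (c : ℝ) : s * c ≤ |c| := by
  rcases hs with rfl | rfl
  · simpa using le_abs_self c
  · simpa using neg_le_abs c

theorem exists_sign_mul_eq_abs (c : ℝ) : ∃ s : ℝ, (s = 1 ∨ s = -1) ∧ s * c = |c| := by
  rcases abs_choice c with h | h
  · exact ⟨1, Or.inl rfl, by simp [h]⟩
  · exact ⟨-1, Or.inr rfl, by simp [h]⟩

/-- The maximum of `⟨P * Q, C⟩_F` over all permutation matrices `P` and all
diagonal matrices `Q` with entries in `{+1, -1}` equals the maximum of `⟨P, |C|⟩_F` over all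
permutation matrices `P`, where `|C|` is the entrywise absolute value of `C`. -/
theorem signed_assignment_reduces_to_abs_assignment (N : ℕ) (hN : 0 < N)
    (C : Matrix (Fin N) (Fin N) ℝ) :
    sSup {x : ℝ | ∃ (π : Equiv.Perm (Fin N)) (q : Fin N → ℝ),
        (∀ i, q i = 1 ∨ q i = -1) ∧
        x = ∑ i, ∑ j,
          ((Matrix.of fun i j => if j = π i then (1 : ℝ) else 0) * Matrix.diagonal q) i j * C i j}
      = sSup {x : ℝ | ∃ π : Equiv.Perm (Fin N),
        x = ∑ i, ∑ j, (if j = π i then (1 : ℝ) else 0) * |C i j|} := by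
  simp only [sum_permMatrix_mul_diagonal_mul, sum_permMatrix_mul_abs]
  have hbdd : BddAbove {x : ℝ | ∃ π : Equiv.Perm (Fin N), x = ∑ i, |C i (π i)|} := by
    refine ((Set.finite_range fun π : Equiv.Perm (Fin N) => ∑ i, |C i (π i)|).subset ?_).bddAbove
    rintro x ⟨π, rfl⟩
    exact ⟨π, rfl⟩
  have hle : ∀ (π : Equiv.Perm (Fin N)) (q : Fin N → ℝ), (∀ i, q i = 1 ∨ q i = -1) →
      ∑ i, q (π i) * C i (π i) ≤ sSup {x : ℝ | ∃ π : Equiv.Perm (Fin N), x = ∑ i, |C i (π i)|} :=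
    fun π q hq =>
      (Finset.sum_le_sum fun i _ => sign_mul_le_abs (hq (π i)) _).trans (le_csSup hbdd ⟨π, rfl⟩)
  apply le_antisymm
  · refine csSup_le ⟨_, 1, fun _ => 1, fun _ => Or.inl rfl, rfl⟩ ?_
    rintro x ⟨π, q, hq, rfl⟩
    exact hle π q hq
  · refine csSup_le ⟨_, 1, rfl⟩ ?_
    rintro x ⟨π, rfl⟩
    choose s hs hsC using fun i => exists_sign_mul_eq_abs (C i (π i))
    refine le_csSup ⟨sSup {x : ℝ | ∃ π : Equiv.Perm (Fin N), x = ∑ i, |C i (π i)|}, ?_⟩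
      ⟨π, fun j => s (π.symm j), fun j => hs _, by simp [hsC]⟩
    rintro y ⟨σ, q, hq, rfl⟩
    exact hle σ q hq
end

section
/- Let Γ_1, Γ_2 be linear maps from ℝ^{k} to ℝ^{k}, ρ: ℝ^{k} × ℝ^{k} → ℝ^{2k} an arbitrary function, and ScaleEq(u, v) = [Γ_1 u, Γ_2 v] ⊙ ρ(u/‖u‖, v/‖v‖). Let Γ_y, Γ_e be linear maps from ℝ^{k} to ℝ^{k} and ReScaleEq(y, e) = (Γ_y y) ⊙ (Γ_e e). Define the scale-equivariant message function MSG_SE(x, y, e) = ScaleEq(x, ReScaleEq(y, e)). Then for all scalars d_ℓ > 0 and d_{ℓ−1} > 0 and all x, y, e ∈ ℝ^{k} with x ≠ 0 and ReScaleEq(y,e) ≠ 0, MSG_SE(d_ℓ·x, d_{ℓ−1}·y, (d_ℓ/d_{ℓ−1})·e) = d_ℓ · MSG_SE(x, y, e). -/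
/-- The Euclidean (L2) norm of a vector in `ℝ^k`. -/
noncomputable def eNorm {k : ℕ} (v : Fin k → ℝ) : ℝ := Real.sqrt (∑ j, v j ^ 2)

theorem eNorm_smul_of_pos {k : ℕ} {d : ℝ} (hd : 0 < d) (v : Fin k → ℝ) :
    eNorm (d • v) = d * eNorm v := by
  simp only [eNorm, Pi.smul_apply, smul_eq_mul, mul_pow, ← Finset.mul_sum]
  rw [Real.sqrt_mul (sq_nonneg d), Real.sqrt_sq hd.le]

/-- The L2 canonicalization is invariant under positive rescaling. -/
theorem inv_eNorm_smul_smul_of_pos {k : ℕ} {d : ℝ} (hd : 0 < d) (v : Fin k → ℝ) :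
    (eNorm (d • v))⁻¹ • d • v = (eNorm v)⁻¹ • v := by
  rw [eNorm_smul_of_pos hd, smul_smul, mul_inv_rev, inv_mul_cancel_right₀ hd.ne']

/-- With `ScaleEq (u, v) = [Γ₁ u, Γ₂ v] ⊙ ρ (u/‖u‖, v/‖v‖)` (concatenation
modeled as `Fin k ⊕ Fin k → ℝ`) and `ReScaleEq (y, e) = (Γy y) ⊙ (Γe e)`, the message
function `MSG_SE (x, y, e) = ScaleEq (x, ReScaleEq (y, e))` satisfies, for `dℓ, dℓ₁ > 0` and
`x ≠ 0`, `ReScaleEq (y, e) ≠ 0`: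
`MSG_SE (dℓ • x, dℓ₁ • y, (dℓ/dℓ₁) • e) = dℓ • MSG_SE (x, y, e)`. -/
theorem msg_se_scale_equivariant (k : ℕ)
    (Γ₁ Γ₂ Γy Γe : (Fin k → ℝ) →ₗ[ℝ] (Fin k → ℝ))
    (ρ : (Fin k → ℝ) → (Fin k → ℝ) → (Fin k ⊕ Fin k → ℝ))
    (ScaleEq : (Fin k → ℝ) → (Fin k → ℝ) → (Fin k ⊕ Fin k → ℝ))
    (hSE : ∀ u v, ScaleEq u v = fun s =>
      Sum.elim (Γ₁ u) (Γ₂ v) s * ρ ((eNorm u)⁻¹ • u) ((eNorm v)⁻¹ • v) s)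
    (ReScaleEq : (Fin k → ℝ) → (Fin k → ℝ) → (Fin k → ℝ))
    (hRSE : ∀ y e, ReScaleEq y e = fun j => Γy y j * Γe e j)
    (MSG : (Fin k → ℝ) → (Fin k → ℝ) → (Fin k → ℝ) → (Fin k ⊕ Fin k → ℝ))
    (hMSG : ∀ x y e, MSG x y e = ScaleEq x (ReScaleEq y e))
    (dl dl1 : ℝ) (hdl : 0 < dl) (hdl1 : 0 < dl1)
    (x y e : Fin k → ℝ) (hx : x ≠ 0) (hre : ReScaleEq y e ≠ 0) :
    MSG (dl • x) (dl1 • y) ((dl / dl1) • e) = dl • MSG x y e := by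
  have hR : ReScaleEq (dl1 • y) ((dl / dl1) • e) = dl • ReScaleEq y e := by
    ext j
    simp only [hRSE, map_smul, Pi.smul_apply, smul_eq_mul]
    field_simp
  rw [hMSG, hMSG, hR, hSE, hSE]
  ext s
  simp only [inv_eNorm_smul_smul_of_pos hdl, map_smul, Pi.smul_apply]
  cases s <;> simp [mul_assoc]
end
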